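/- Let (V, μ, R) be a braided commutative braided algebra over a commutative ring k. Then for every linear map f : V → V the braided-commutativity component of the second differential vanishes on δ¹ of f: μ∘δ¹_YB(f) + δ¹_H(f)∘R − δ¹_H(f) = 0. Together with the vanishing of the Yang–Baxter Hochschild components, this shows that δ²_BC ∘ δ¹_BC = 0, i.e., C¹_BC → C²_BC → C³_BC is a cochain complex. -/

import Mathlib

open TensorProduct LinearMap

noncomputable section

variable {k : Type*} [CommRing k] {V : Type*} [AddCommGroup V] [Module k V]

/-- `g ⊗ 1` acting on `(V ⊗ V) ⊗ V`, for `g : V ⊗ V → V ⊗ V`. -/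
def rT2 (g : V ⊗[k] V →ₗ[k] V ⊗[k] V) :
    (V ⊗[k] V) ⊗[k] V →ₗ[k] (V ⊗[k] V) ⊗[k] V :=
  g.rTensor V

/-- `1 ⊗ g` acting on `(V ⊗ V) ⊗ V`, for `g : V ⊗ V → V ⊗ V`. -/
def lT2 (g : V ⊗[k] V →ₗ[k] V ⊗[k] V) :
    (V ⊗[k] V) ⊗[k] V →ₗ[k] (V ⊗[k] V) ⊗[k] V :=
  (TensorProduct.assoc k V V V).symm.toLinearMap ∘ₗ g.lTensor V ∘ₗ
    (TensorProduct.assoc k V V V).toLinearMap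

/-- `h ⊗ 1 : V ⊗ V ⊗ V → V ⊗ V`, for `h : V ⊗ V → V`. -/
def rT21 (h : V ⊗[k] V →ₗ[k] V) :
    (V ⊗[k] V) ⊗[k] V →ₗ[k] V ⊗[k] V :=
  h.rTensor V

/-- `1 ⊗ h : V ⊗ V ⊗ V → V ⊗ V`, for `h : V ⊗ V → V`. -/
def lT21 (h : V ⊗[k] V →ₗ[k] V) :
    (V ⊗[k] V) ⊗[k] V →ₗ[k] V ⊗[k] V :=
  h.lTensor V ∘ₗ (TensorProduct.assoc k V V V).toLinearMap

/-- first Hochschild differential -/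
def d1H (μ : V ⊗[k] V →ₗ[k] V) (f : V →ₗ[k] V) : V ⊗[k] V →ₗ[k] V :=
  μ ∘ₗ f.rTensor V + μ ∘ₗ f.lTensor V - f ∘ₗ μ

/-- first Yang-Baxter differential -/
def d1YB (R : V ⊗[k] V →ₗ[k] V ⊗[k] V) (f : V →ₗ[k] V) :
    V ⊗[k] V →ₗ[k] V ⊗[k] V :=
  R ∘ₗ f.rTensor V + R ∘ₗ f.lTensor V - f.rTensor V ∘ₗ R - f.lTensor V ∘ₗ R

/-- second Hochschild differential -/
def d2H (μ : V ⊗[k] V →ₗ[k] V) (ψ : V ⊗[k] V →ₗ[k] V) :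
    (V ⊗[k] V) ⊗[k] V →ₗ[k] V :=
  μ ∘ₗ rT21 ψ + ψ ∘ₗ rT21 μ - μ ∘ₗ lT21 ψ - ψ ∘ₗ lT21 μ

/-- second Yang-Baxter differential -/
def d2YB (R φ : V ⊗[k] V →ₗ[k] V ⊗[k] V) :
    (V ⊗[k] V) ⊗[k] V →ₗ[k] (V ⊗[k] V) ⊗[k] V :=
  rT2 R ∘ₗ lT2 R ∘ₗ rT2 φ + rT2 R ∘ₗ lT2 φ ∘ₗ rT2 R + rT2 φ ∘ₗ lT2 R ∘ₗ rT2 R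
    - lT2 R ∘ₗ rT2 R ∘ₗ lT2 φ - lT2 R ∘ₗ rT2 φ ∘ₗ lT2 R - lT2 φ ∘ₗ rT2 R ∘ₗ lT2 R

/-- YI component of the second Yang-Baxter Hochschild differential -/
def d2YI (μ : V ⊗[k] V →ₗ[k] V) (R φ : V ⊗[k] V →ₗ[k] V ⊗[k] V)
    (ψ : V ⊗[k] V →ₗ[k] V) : (V ⊗[k] V) ⊗[k] V →ₗ[k] V ⊗[k] V :=
  lT21 ψ ∘ₗ rT2 R ∘ₗ lT2 R + lT21 μ ∘ₗ rT2 φ ∘ₗ lT2 R + lT21 μ ∘ₗ rT2 R ∘ₗ lT2 φ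
    - R ∘ₗ rT21 ψ - φ ∘ₗ rT21 μ

/-- IY component of the second Yang-Baxter Hochschild differential -/
def d2IY (μ : V ⊗[k] V →ₗ[k] V) (R φ : V ⊗[k] V →ₗ[k] V ⊗[k] V)
    (ψ : V ⊗[k] V →ₗ[k] V) : (V ⊗[k] V) ⊗[k] V →ₗ[k] V ⊗[k] V :=
  rT21 ψ ∘ₗ lT2 R ∘ₗ rT2 R + rT21 μ ∘ₗ lT2 φ ∘ₗ rT2 R + rT21 μ ∘ₗ lT2 R ∘ₗ rT2 φ
    - R ∘ₗ lT21 ψ - φ ∘ₗ lT21 μ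

/-- `(V,μ,R)` is a braided algebra. -/
structure IsBraidedAlgebra (μ : V ⊗[k] V →ₗ[k] V)
    (R : V ⊗[k] V →ₗ[k] V ⊗[k] V) : Prop where
  assoc : μ ∘ₗ rT21 μ = μ ∘ₗ lT21 μ
  Rbij : Function.Bijective R
  yb : rT2 R ∘ₗ lT2 R ∘ₗ rT2 R = lT2 R ∘ₗ rT2 R ∘ₗ lT2 R
  yi : lT21 μ ∘ₗ rT2 R ∘ₗ lT2 R = R ∘ₗ rT21 μ
  iy : rT21 μ ∘ₗ lT2 R ∘ₗ rT2 R = R ∘ₗ lT21 μ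

/-- The extension of `f` to `V ⊗ V` as a derivation: `f ⊗ 1 + 1 ⊗ f`. -/
def derivTensorTwo (f : V →ₗ[k] V) : V ⊗[k] V →ₗ[k] V ⊗[k] V :=
  f.rTensor V + f.lTensor V

/-- The extension of `f` to `V ⊗ V ⊗ V` as a derivation: `f ⊗ 1 ⊗ 1 + 1 ⊗ f ⊗ 1 + 1 ⊗ 1 ⊗ f`. -/
def derivTensorThree (f : V →ₗ[k] V) :
    (V ⊗[k] V) ⊗[k] V →ₗ[k] (V ⊗[k] V) ⊗[k] V :=
  (derivTensorTwo f).rTensor V + f.lTensor (V ⊗[k] V)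

lemma d1H_eq (μ : V ⊗[k] V →ₗ[k] V) (f : V →ₗ[k] V) :
    d1H μ f = μ ∘ₗ derivTensorTwo f - f ∘ₗ μ := by
  rw [d1H, derivTensorTwo, comp_add]

lemma d1YB_eq (R : V ⊗[k] V →ₗ[k] V ⊗[k] V) (f : V →ₗ[k] V) :
    d1YB R f = R ∘ₗ derivTensorTwo f - derivTensorTwo f ∘ₗ R := by
  rw [d1YB, derivTensorTwo, comp_add, add_comp, sub_sub]

lemma assoc_comp_derivTensorThree (f : V →ₗ[k] V) :
    (TensorProduct.assoc k V V V).toLinearMap ∘ₗ derivTensorThree f =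
      (f.rTensor (V ⊗[k] V) + (derivTensorTwo f).lTensor V) ∘ₗ
        (TensorProduct.assoc k V V V).toLinearMap := by
  ext x y z
  simp [derivTensorThree, derivTensorTwo, add_assoc]

lemma assoc_symm_comp_derivTensorTwo (f : V →ₗ[k] V) :
    (TensorProduct.assoc k V V V).symm.toLinearMap ∘ₗ
        (f.rTensor (V ⊗[k] V) + (derivTensorTwo f).lTensor V) =
      derivTensorThree f ∘ₗ (TensorProduct.assoc k V V V).symm.toLinearMap := by
  rw [LinearEquiv.toLinearMap_symm_comp_eq, ← comp_assoc, assoc_comp_derivTensorThree, comp_assoc,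
    LinearEquiv.comp_symm, comp_id]

lemma rT2_d1YB (R : V ⊗[k] V →ₗ[k] V ⊗[k] V) (f : V →ₗ[k] V) :
    rT2 (d1YB R f) = rT2 R ∘ₗ derivTensorThree f - derivTensorThree f ∘ₗ rT2 R := by
  simp only [d1YB_eq, rT2, derivTensorThree, rTensor_sub, rTensor_comp, comp_add, add_comp,
    rTensor_comp_lTensor, lTensor_comp_rTensor]
  abel

lemma lT2_d1YB (R : V ⊗[k] V →ₗ[k] V ⊗[k] V) (f : V →ₗ[k] V) :
    lT2 (d1YB R f) = lT2 R ∘ₗ derivTensorThree f - derivTensorThree f ∘ₗ lT2 R := by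
  have h : (d1YB R f).lTensor V =
      R.lTensor V ∘ₗ (f.rTensor (V ⊗[k] V) + (derivTensorTwo f).lTensor V) -
        (f.rTensor (V ⊗[k] V) + (derivTensorTwo f).lTensor V) ∘ₗ R.lTensor V := by
    simp only [d1YB_eq, lTensor_sub, lTensor_comp, comp_add, add_comp,
      rTensor_comp_lTensor, lTensor_comp_rTensor]
    abel
  simp only [lT2, comp_assoc, assoc_comp_derivTensorThree]
  rw [← comp_assoc _ _ (derivTensorThree f), ← assoc_symm_comp_derivTensorTwo, h]
  simp only [comp_sub, sub_comp, comp_assoc]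

lemma rT21_d1H (μ : V ⊗[k] V →ₗ[k] V) (f : V →ₗ[k] V) :
    rT21 (d1H μ f) = rT21 μ ∘ₗ derivTensorThree f - derivTensorTwo f ∘ₗ rT21 μ := by
  rw [d1H_eq]
  simp only [rT21, derivTensorThree, derivTensorTwo.eq_1 f, rTensor_sub, rTensor_comp,
    rTensor_add, comp_add, add_comp, rTensor_comp_lTensor, lTensor_comp_rTensor]
  abel

lemma lT21_d1H (μ : V ⊗[k] V →ₗ[k] V) (f : V →ₗ[k] V) :
    lT21 (d1H μ f) = lT21 μ ∘ₗ derivTensorThree f - derivTensorTwo f ∘ₗ lT21 μ := by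
  simp only [lT21, comp_assoc, assoc_comp_derivTensorThree]
  simp only [d1H_eq, ← comp_assoc, ← sub_comp]
  congr 1
  simp only [lTensor_sub, lTensor_comp, lTensor_add, comp_add, derivTensorTwo.eq_1 f, add_comp,
    rTensor_comp_lTensor, lTensor_comp_rTensor]
  abel

/-- for a braided commutative braided algebra `(V, μ, R)`, the
braided-commutativity component of the second differential vanishes on `δ¹` of
any `f : V → V`: `μ ∘ δ¹_YB(f) + δ¹_H(f) ∘ R − δ¹_H(f) = 0`.  Together with the
vanishing of the Yang-Baxter Hochschild components this gives
`δ²_BC ∘ δ¹_BC = 0`, so `C¹_BC → C²_BC → C³_BC` is a cochain complex. -/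
theorem d2BC_d1BC_eq_zero {k : Type*} [CommRing k] {V : Type*} [AddCommGroup V]
    [Module k V] (μ : V ⊗[k] V →ₗ[k] V) (R : V ⊗[k] V →ₗ[k] V ⊗[k] V)
    (hBA : IsBraidedAlgebra μ R) (hBC : μ ∘ₗ R = μ) (f : V →ₗ[k] V) :
    (μ ∘ₗ d1YB R f + d1H μ f ∘ₗ R - d1H μ f = 0) ∧
    d2YB R (d1YB R f) = 0 ∧
    d2YI μ R (d1YB R f) (d1H μ f) = 0 ∧
    d2IY μ R (d1YB R f) (d1H μ f) = 0 ∧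
    d2H μ (d1H μ f) = 0 := by
  have hμR (x) : μ (R x) = μ x := LinearMap.congr_fun hBC x
  refine ⟨?_, ?_, ?_, ?_, ?_⟩
  · rw [d1YB_eq, d1H_eq]
    refine LinearMap.ext fun x ↦ ?_
    simp only [comp_apply, LinearMap.sub_apply, LinearMap.add_apply, map_sub,
      LinearMap.zero_apply, hμR]
    abel
  · have h (x) := LinearMap.congr_fun hBA.yb x
    simp only [comp_apply] at h
    rw [d2YB, rT2_d1YB, lT2_d1YB]
    refine LinearMap.ext fun x ↦ ?_
    simp only [comp_apply, LinearMap.sub_apply, LinearMap.add_apply, map_sub,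
      LinearMap.zero_apply, h]
    abel
  · have h (x) := LinearMap.congr_fun hBA.yi x
    simp only [comp_apply] at h
    rw [d2YI, rT2_d1YB, lT2_d1YB, rT21_d1H, lT21_d1H, d1YB_eq]
    refine LinearMap.ext fun x ↦ ?_
    simp only [comp_apply, LinearMap.sub_apply, LinearMap.add_apply, map_sub,
      LinearMap.zero_apply, h]
    abel
  · have h (x) := LinearMap.congr_fun hBA.iy x
    simp only [comp_apply] at h
    rw [d2IY, rT2_d1YB, lT2_d1YB, rT21_d1H, lT21_d1H, d1YB_eq]
    refine LinearMap.ext fun x ↦ ?_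
    simp only [comp_apply, LinearMap.sub_apply, LinearMap.add_apply, map_sub,
      LinearMap.zero_apply, h]
    abel
  · have h (x) := LinearMap.congr_fun hBA.assoc x
    simp only [comp_apply] at h
    rw [d2H, rT21_d1H, lT21_d1H, d1H_eq]
    refine LinearMap.ext fun x ↦ ?_
    simp only [comp_apply, LinearMap.sub_apply, LinearMap.add_apply, map_sub,
      LinearMap.zero_apply, h]
    abel

end
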